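/- arXiv:0711.2169 — 3 statements merged into one kernel-verified Lean document; each statement's English description precedes it below -/
import Mathlib

section
/- Let $X_n$ be a time-homogeneous Markov chain on $\mathbf{R}$ with jump variables $\xi(x)$, and suppose there exists $A>0$ with $\varepsilon\equiv\inf_{x\in\mathbf{R}}\mathbf{E}(\xi(x)\wedge A)>0$. Fix $x\in\mathbf{R}$ and $h>0$, let the chain start at a point $X_0\in(x,x+h]$, and let $\tau=\min\{n\ge1: X_n>x+h\}$ be the first exit time above level $x+h$. Then $\mathbf{E}\tau\le (A+h)/\varepsilon$; in particular, the expected number of visits of the chain to the interval $(x,x+h]$ before the first exit from $(-\infty,x+h]$ is at most $(A+h)/\varepsilon$, uniformly over the initial state $X_0\in(x,x+h]$. -/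
open MeasureTheory ProbabilityTheory Filter Set

/-- The law of the jump `ξ(x)` of the chain at state `x`. -/
noncomputable def jumpLaw (P : Kernel ℝ ℝ) (x : ℝ) : Measure ℝ :=
  (P x).map (fun y => y - x)

/-- `stayBelowHit P c I n x` is the probability that the chain started at `x`
satisfies `X_1 ≤ c, …, X_n ≤ c` and `X_n ∈ I`; in particular with `I = univ` it
is `P{τ > n}` where `τ = min{n ≥ 1 : X_n > c}`, so that
`∑_{n ≥ 0} stayBelowHit P c univ n x = E τ`, and with `I = (x, x+h]` the sum
`∑_{n ≥ 0} stayBelowHit P (x+h) I n x₀` is the expected number of visits to `I`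
before the first exit from `(-∞, x+h]`. -/
noncomputable def stayBelowHit (P : Kernel ℝ ℝ) (c : ℝ) (I : Set ℝ) : ℕ → ℝ → ENNReal
  | 0, x => I.indicator 1 x
  | n + 1, x => ∫⁻ y in Set.Iic c, stayBelowHit P c I n y ∂(P x)

theorem sbh_measurable (P : Kernel ℝ ℝ) [IsMarkovKernel P] (c : ℝ) (n : ℕ) :
    Measurable (stayBelowHit P c Set.univ n) := by
  induction n with
  | zero =>
    have : stayBelowHit P c Set.univ 0 = fun _ => 1 := by
      funext x; simp [stayBelowHit]
    rw [this]; exact measurable_const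
  | succ n ih =>
    have : stayBelowHit P c Set.univ (n+1) =
        fun x => ∫⁻ y, stayBelowHit P c Set.univ n y
          ∂((P.restrict (measurableSet_Iic : MeasurableSet (Set.Iic c))) x) := by
      funext x; simp [stayBelowHit, Kernel.restrict_apply]
    rw [this]; exact ih.lintegral_kernel

theorem sbh_mono (P : Kernel ℝ ℝ) (c : ℝ) (I : Set ℝ) (n : ℕ) (x : ℝ) :
    stayBelowHit P c I n x ≤ stayBelowHit P c Set.univ n x := by
  induction n generalizing x with
  | zero =>
    simp only [stayBelowHit]
    exact Set.indicator_le_indicator_of_subset (Set.subset_univ _) (fun _ => zero_le) x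
  | succ n ih =>
    simp only [stayBelowHit]
    exact lintegral_mono ih

theorem sbh_drift (P : Kernel ℝ ℝ) [IsMarkovKernel P]
    (A : ℝ) (ε : ℝ) (hε : 0 < ε)
    (hdrift : ∀ x : ℝ, ε ≤ ∫ s, min s A ∂(jumpLaw P x)) (c y : ℝ) (hy : y ≤ c) :
    1 + ∫⁻ z in Set.Iic c, ENNReal.ofReal ((c + A - z) / ε) ∂(P y)
      ≤ ENNReal.ofReal ((c + A - y) / ε) := by
  have hd := hdrift y
  have hm : Measurable (fun z : ℝ => z - y) := by fun_prop
  have hsm : Measurable (fun s : ℝ => min s A) := by fun_prop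
  rw [jumpLaw, integral_map hm.aemeasurable hsm.aestronglyMeasurable] at hd
  have hint : Integrable (fun z => min (z - y) A) (P y) := by
    by_contra hn
    rw [integral_undef hn] at hd
    linarith
  have hgi : Integrable (fun z => (c + A - y - min (z - y) A) / ε) (P y) :=
    ((integrable_const _).sub hint).div_const _
  have hg0 : ∀ z, 0 ≤ (c + A - y - min (z - y) A) / ε := fun z =>
    div_nonneg (by linarith [min_le_right (z - y) A]) hε.le
  have hval : ∫ z, (c + A - y - min (z - y) A) / ε ∂(P y)
      = (c + A - y - ∫ z, min (z - y) A ∂(P y)) / ε := by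
    rw [integral_div, integral_sub (integrable_const _) hint]
    simp
  have hnn : 0 ≤ ∫ z, (c + A - y - min (z - y) A) / ε ∂(P y) := integral_nonneg hg0
  have hle : ∫ z, (c + A - y - min (z - y) A) / ε ∂(P y) + 1 ≤ (c + A - y) / ε := by
    rw [hval, div_add_one hε.ne']
    gcongr
    linarith
  calc 1 + ∫⁻ z in Set.Iic c, ENNReal.ofReal ((c + A - z) / ε) ∂(P y)
      ≤ 1 + ∫⁻ z, ENNReal.ofReal ((c + A - y - min (z - y) A) / ε) ∂(P y) := by
        gcongr 1 + ?_
        refine (setLIntegral_le_lintegral _ _).trans (lintegral_mono fun z => ?_)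
        apply ENNReal.ofReal_le_ofReal
        refine div_le_div_of_nonneg_right ?_ hε.le
        linarith [min_le_left (z - y) A]
    _ = ENNReal.ofReal (∫ z, (c + A - y - min (z - y) A) / ε ∂(P y) + 1) := by
        rw [← ofReal_integral_eq_lintegral_ofReal hgi (Eventually.of_forall hg0),
          ENNReal.ofReal_add hnn zero_le_one, ENNReal.ofReal_one, add_comm]
    _ ≤ _ := ENNReal.ofReal_le_ofReal hle

theorem sbh_sum_bound (P : Kernel ℝ ℝ) [IsMarkovKernel P]
    (A : ℝ) (ε : ℝ) (hε : 0 < ε)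
    (hdrift : ∀ x : ℝ, ε ≤ ∫ s, min s A ∂(jumpLaw P x)) (c : ℝ) (N : ℕ) :
    ∀ y ≤ c, ∑ n ∈ Finset.range N, stayBelowHit P c Set.univ n y
      ≤ ENNReal.ofReal ((c + A - y) / ε) := by
  induction N with
  | zero => intro y _; simp
  | succ N ih =>
    intro y hy
    refine le_trans ?_ (sbh_drift P A ε hε hdrift c y hy)
    rw [Finset.sum_range_succ', add_comm]
    gcongr ?_ + ?_
    · simp [stayBelowHit]
    · simp only [stayBelowHit]
      rw [← lintegral_finsetSum _ (fun n _ => sbh_measurable P c n)]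
      exact setLIntegral_mono' measurableSet_Iic ih

/-- **Exit-time estimate.** If `ε = inf_x E(ξ(x) ∧ A) > 0` for some `A > 0`,
then for the chain started at any `x₀ ∈ (x, x+h]` the first exit time
`τ = min{n ≥ 1 : X_n > x+h}` satisfies `E τ ≤ (A+h)/ε`; in particular the
expected number of visits to `(x, x+h]` before the first exit from `(-∞, x+h]`
is at most `(A+h)/ε`, uniformly over the initial state `x₀ ∈ (x, x+h]`. -/
theorem exit_time_bound
    (P : Kernel ℝ ℝ) [IsMarkovKernel P]
    (A : ℝ) (hA : 0 < A)
    (ε : ℝ) (hε : 0 < ε)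
    -- `ε ≤ E (ξ(x) ∧ A)` for all `x`:
    (hdrift : ∀ x : ℝ, ε ≤ ∫ s, min s A ∂(jumpLaw P x))
    (x h : ℝ) (hh : 0 < h) :
    ∀ x0 ∈ Set.Ioc x (x + h),
      (∑' n : ℕ, stayBelowHit P (x + h) Set.univ n x0 ≤ ENNReal.ofReal ((A + h) / ε))
        ∧ (∑' n : ℕ, stayBelowHit P (x + h) (Set.Ioc x (x + h)) n x0 ≤
            ENNReal.ofReal ((A + h) / ε)) := by
  intro x0 hx0
  have key : ∑' n : ℕ, stayBelowHit P (x + h) Set.univ n x0 ≤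
      ENNReal.ofReal ((A + h) / ε) := by
    rw [ENNReal.tsum_eq_iSup_nat]
    refine iSup_le fun N => (sbh_sum_bound P A ε hε hdrift (x + h) N x0 hx0.2).trans ?_
    apply ENNReal.ofReal_le_ofReal
    gcongr
    linarith [hx0.1]
  exact ⟨key, (ENNReal.tsum_le_tsum fun n => sbh_mono P _ _ n x0).trans key⟩
end

section
/- Let $X_n$ be a time-homogeneous Markov chain on $\mathbf{R}$ with nonnegative jumps, i.e. $\xi(x)\ge0$ almost surely for every $x$, and suppose there exists $A>0$ with $\gamma\equiv\inf_{x\in\mathbf{R}}\mathbf{P}\{\xi(x)>A\}>0$. Then the renewal measure satisfies $U(x,x+h]\le (A+h)/(\gamma^2 A)$ for all $x\in\mathbf{R}$ and $h>0$. -/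
open MeasureTheory ProbabilityTheory Filter Set

/-- The distribution of the Markov chain with transition kernel `P` and initial
distribution `μ0` at time `n`. -/
noncomputable def chainDist (P : Kernel ℝ ℝ) (μ0 : Measure ℝ) : ℕ → Measure ℝ
  | 0 => μ0
  | n + 1 => (chainDist P μ0 n).bind P

/-- The renewal measure `U(B) = ∑_{n≥0} P{X_n ∈ B}`. -/
noncomputable def renewalMeasure (P : Kernel ℝ ℝ) (μ0 : Measure ℝ) : Measure ℝ :=
  Measure.sum (chainDist P μ0)

lemma chainDist_isProb (P : Kernel ℝ ℝ) [IsMarkovKernel P]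
    (μ0 : Measure ℝ) [IsProbabilityMeasure μ0] (n : ℕ) :
    IsProbabilityMeasure (chainDist P μ0 n) := by
  induction n with
  | zero => simpa [chainDist] using (inferInstance : IsProbabilityMeasure μ0)
  | succ n ih =>
    constructor
    rw [chainDist, Measure.bind_apply MeasurableSet.univ P.measurable.aemeasurable]
    simp

lemma kernel_Ioi_lower (P : Kernel ℝ ℝ) [IsMarkovKernel P]
    (hnonneg : ∀ x : ℝ, jumpLaw P x {s : ℝ | s < 0} = 0)
    (A γ : ℝ)
    (hjump : ∀ x : ℝ, ENNReal.ofReal γ ≤ jumpLaw P x (Set.Ioi A)) (a y : ℝ) :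
    (Set.Ioi (a + A)).indicator (fun _ => (1 : ENNReal)) y
      + (Set.Ioc a (a + A)).indicator (fun _ => ENNReal.ofReal γ) y ≤ P y (Set.Ioi (a + A)) := by
  have hm : Measurable (fun z : ℝ => z - y) := by fun_prop
  by_cases h1 : a + A < y
  · have h2 : y ∉ Set.Ioc a (a + A) := fun h => absurd h.2 (not_le.2 h1)
    rw [Set.indicator_of_mem (by exact h1), Set.indicator_of_notMem h2, add_zero]
    have h0 := hnonneg y
    rw [jumpLaw, Measure.map_apply hm (show MeasurableSet {s : ℝ | s < 0} from measurableSet_Iio)] at h0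
    have h3 : P y (Set.Ioi (a + A))ᶜ = 0 := by
      refine measure_mono_null ?_ h0
      intro z hz
      simp only [Set.mem_compl_iff, Set.mem_Ioi, not_lt] at hz
      simp only [Set.mem_preimage, Set.mem_setOf_eq]
      linarith
    exact ((prob_compl_eq_zero_iff measurableSet_Ioi).1 h3).ge
  · rw [Set.indicator_of_notMem (by exact h1), zero_add]
    by_cases h2 : y ∈ Set.Ioc a (a + A)
    · rw [Set.indicator_of_mem h2]
      refine (hjump y).trans ?_
      rw [jumpLaw, Measure.map_apply hm measurableSet_Ioi]
      refine measure_mono ?_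
      intro z hz
      simp only [Set.mem_preimage, Set.mem_Ioi] at hz ⊢
      linarith [h2.1]
    · rw [Set.indicator_of_notMem h2]
      exact zero_le

lemma renewal_Ioc_le (P : Kernel ℝ ℝ) [IsMarkovKernel P]
    (μ0 : Measure ℝ) [IsProbabilityMeasure μ0]
    (hnonneg : ∀ x : ℝ, jumpLaw P x {s : ℝ | s < 0} = 0)
    (A γ : ℝ) (hγ : 0 < γ)
    (hjump : ∀ x : ℝ, ENNReal.ofReal γ ≤ jumpLaw P x (Set.Ioi A)) (a : ℝ) :
    renewalMeasure P μ0 (Set.Ioc a (a + A)) ≤ ENNReal.ofReal (1 / γ) := by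
  have step : ∀ n, chainDist P μ0 n (Set.Ioi (a + A))
      + ENNReal.ofReal γ * chainDist P μ0 n (Set.Ioc a (a + A))
      ≤ chainDist P μ0 (n + 1) (Set.Ioi (a + A)) := by
    intro n
    rw [chainDist, Measure.bind_apply measurableSet_Ioi P.measurable.aemeasurable]
    refine le_trans (le_of_eq ?_)
      (lintegral_mono (kernel_Ioi_lower P hnonneg A γ hjump a))
    rw [lintegral_add_left (measurable_const.indicator measurableSet_Ioi),
      lintegral_indicator_const measurableSet_Ioi, lintegral_indicator_const measurableSet_Ioc,
      one_mul]
  have tot : ∀ N, ENNReal.ofReal γ *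
      ∑ n ∈ Finset.range N, chainDist P μ0 n (Set.Ioc a (a + A))
      ≤ chainDist P μ0 N (Set.Ioi (a + A)) := by
    intro N
    induction N with
    | zero => simp
    | succ N ih =>
      rw [Finset.sum_range_succ, mul_add]
      exact (add_le_add_left ih _).trans (step N)
  rw [renewalMeasure, Measure.sum_apply _ measurableSet_Ioc]
  refine ENNReal.tsum_le_of_sum_range_le fun N => ?_
  rw [one_div, ENNReal.ofReal_inv_of_pos hγ, ENNReal.le_inv_iff_mul_le, mul_comm]
  have := chainDist_isProb P μ0 N
  exact (tot N).trans prob_le_one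

/-- If the chain has nonnegative jumps `ξ(x) ≥ 0` and
`γ = inf_x P{ξ(x) > A} > 0` for some `A > 0`, then the renewal measure
satisfies `U(x, x+h] ≤ (A+h)/(γ²A)` for all `x ∈ ℝ` and `h > 0`. -/
theorem renewal_measure_bound_nonneg_jumps
    (P : Kernel ℝ ℝ) [IsMarkovKernel P]
    (μ0 : Measure ℝ) [IsProbabilityMeasure μ0]
    -- nonnegative jumps:
    (hnonneg : ∀ x : ℝ, jumpLaw P x {s : ℝ | s < 0} = 0)
    (A : ℝ) (hA : 0 < A)
    (γ : ℝ) (hγ : 0 < γ)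
    -- `γ ≤ P{ξ(x) > A}` for all `x`:
    (hjump : ∀ x : ℝ, ENNReal.ofReal γ ≤ jumpLaw P x (Set.Ioi A)) :
    ∀ x : ℝ, ∀ h : ℝ, 0 < h →
      renewalMeasure P μ0 (Set.Ioc x (x + h)) ≤
        ENNReal.ofReal ((A + h) / (γ ^ 2 * A)) := by
  intro x h hh
  have cover : ∀ k : ℕ, renewalMeasure P μ0 (Set.Ioc x (x + k * A))
      ≤ k * ENNReal.ofReal (1 / γ) := by
    intro k
    induction k with
    | zero => simp
    | succ k ih =>
      have hsub : Set.Ioc x (x + ((k + 1 : ℕ) : ℝ) * A)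
          ⊆ Set.Ioc x (x + k * A) ∪ Set.Ioc (x + k * A) (x + k * A + A) := by
        intro y hy
        obtain ⟨h1, h2⟩ := hy
        push_cast at h2
        rcases le_or_gt y (x + k * A) with h3 | h3
        · exact Or.inl ⟨h1, h3⟩
        · exact Or.inr ⟨h3, by linarith⟩
      refine (measure_mono hsub).trans ((measure_union_le _ _).trans ?_)
      push_cast
      rw [add_mul, one_mul]
      exact add_le_add ih (renewal_Ioc_le P μ0 hnonneg A γ hγ hjump _)
  have hγ1 : γ ≤ 1 := by
    have h1 := hjump 0
    have hp : IsProbabilityMeasure (jumpLaw P 0) :=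
      Measure.isProbabilityMeasure_map (by fun_prop)
    have h2 := h1.trans prob_le_one
    exact ENNReal.ofReal_le_one.1 h2
  have hk1 : h ≤ (⌈h / A⌉₊ : ℝ) * A := (div_le_iff₀ hA).1 (Nat.le_ceil _)
  have hk2 : (⌈h / A⌉₊ : ℝ) ≤ h / A + 1 := (Nat.ceil_lt_add_one (by positivity)).le
  refine (measure_mono (Set.Ioc_subset_Ioc_right (by linarith))).trans
    ((cover ⌈h / A⌉₊).trans ?_)
  rw [← ENNReal.ofReal_natCast, ← ENNReal.ofReal_mul (by positivity)]
  apply ENNReal.ofReal_le_ofReal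
  calc (⌈h / A⌉₊ : ℝ) * (1 / γ) ≤ (h / A + 1) * (1 / γ ^ 2) := by
        gcongr
        nlinarith
    _ = (A + h) / (γ ^ 2 * A) := by
        field_simp
        ring
end

section
/- Let $X_n$ be a time-homogeneous Markov chain on $\mathbf{R}$ with jump variables $\xi(x)$ satisfying: (i) $\xi(x)\Rightarrow\xi$ weakly as $x\to\infty$ where $\xi$ has distribution $F$ and $\mathbf{E}\xi>0$; (ii) $|\xi(x)|\le_{\rm st}\eta$ for all $x$ with $\mathbf{E}\eta<\infty$; (iii) $\sup_{k\in\mathbf{Z}}U(k,k+1]<\infty$. Suppose $t_n\to\infty$ is such that $U(t_n+dx)\Rightarrow\alpha\,dx$ (weak convergence on bounded intervals to $\alpha$ times Lebesgue measure). Then for every fixed $k\ge0$, writing $U_k=\sum_{j=k}^\infty\mu_j$ where $\mu_j$ is the distribution of $X_j$, the identity $\mu_k(0,\infty)= -\int_{-\infty}^0 P(y,(0,\infty))\,U_k(dy)+\int_0^\infty P(y,(-\infty,0])\,U_k(dy)+\alpha\,\mathbf{E}\xi$ holds. -/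
open MeasureTheory ProbabilityTheory Filter Set

/-- The shifted renewal measure `U_k = ∑_{j≥k} μ_j`. -/
noncomputable def renewalTail (P : Kernel ℝ ℝ) (μ0 : Measure ℝ) (k : ℕ) : Measure ℝ :=
  Measure.sum (fun j : ℕ => chainDist P μ0 (k + j))

namespace BalanceAux

/-- The ramp function: `1` on `(-∞,0]`, `0` on `[1,∞)`, linear in between. -/
noncomputable def ramp (x : ℝ) : ℝ := max 0 (min 1 (1 - x))

lemma ramp_nonneg (x : ℝ) : 0 ≤ ramp x := le_max_left _ _

lemma ramp_le_one (x : ℝ) : ramp x ≤ 1 := max_le zero_le_one (min_le_left _ _)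

lemma ramp_cont : Continuous ramp := by unfold ramp; fun_prop

lemma ramp_of_nonpos {x : ℝ} (h : x ≤ 0) : ramp x = 1 := by
  unfold ramp; rw [min_eq_left (by linarith)]; simp

lemma ramp_of_one_le {x : ℝ} (h : 1 ≤ x) : ramp x = 0 := by
  unfold ramp; rw [min_eq_right (by linarith)]; exact max_eq_left (by linarith)

lemma ramp_anti {x y : ℝ} (h : x ≤ y) : ramp y ≤ ramp x := by
  unfold ramp; gcongr

lemma ramp_lip (x y : ℝ) : |ramp x - ramp y| ≤ |x - y| := by
  unfold ramp
  refine (abs_max_sub_max_le_max _ _ _ _).trans ?_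
  refine max_le (by simp) ?_
  refine (abs_min_sub_min_le_max _ _ _ _).trans ?_
  simp [abs_sub_comm]

/-- The smoothed increment. -/
noncomputable def incr (x s : ℝ) : ℝ := ramp x - ramp (x + s)

lemma incr_cont : Continuous (fun p : ℝ × ℝ => incr p.1 p.2) := by
  unfold incr
  exact (ramp_cont.comp continuous_fst).sub (ramp_cont.comp (continuous_fst.add continuous_snd))

lemma incr_cont_right (x : ℝ) : Continuous (incr x) :=
  incr_cont.comp (Continuous.prodMk continuous_const continuous_id)

lemma incr_cont_left (s : ℝ) : Continuous (fun x => incr x s) :=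
  incr_cont.comp (Continuous.prodMk continuous_id continuous_const)

lemma abs_incr_le_one (x s : ℝ) : |incr x s| ≤ 1 := by
  unfold incr
  rw [abs_le]
  constructor <;> linarith [ramp_nonneg x, ramp_nonneg (x + s), ramp_le_one x, ramp_le_one (x + s)]

lemma incr_eq_zero {x s : ℝ} (h : |s| < |x| - 1) : incr x s = 0 := by
  unfold incr
  have h1 := abs_lt.mp (lt_of_lt_of_le h le_rfl)
  rcases le_total 0 x with hx | hx
  · rw [abs_of_nonneg hx] at h1
    rw [ramp_of_one_le (by linarith), ramp_of_one_le (by linarith)]; simp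
  · rw [abs_of_nonpos hx] at h1
    rw [ramp_of_nonpos (by linarith), ramp_of_nonpos (by linarith)]; simp

lemma abs_incr_le_ind {x s a : ℝ} (h : a < |x| - 1) :
    |incr x s| ≤ Set.indicator {s : ℝ | a < |s|} (fun _ => (1 : ℝ)) s := by
  by_cases hs : a < |s|
  · rw [Set.indicator_of_mem (by exact hs)]; exact abs_incr_le_one x s
  · rw [Set.indicator_of_notMem (by exact hs), incr_eq_zero (by linarith)]; simp

lemma incr_lip (x y s : ℝ) : |incr x s - incr y s| ≤ 2 * |x - y| := by
  unfold incr
  have h1 := abs_le.mp (ramp_lip x y)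
  have h2 := abs_le.mp (ramp_lip (x + s) (y + s))
  rw [add_sub_add_right_eq_sub] at h2
  rw [abs_le]; constructor <;> linarith [h1.1, h1.2, h2.1, h2.2]

lemma incr_integrable_right (Q : Measure ℝ) [IsFiniteMeasure Q] (x : ℝ) :
    Integrable (incr x) Q :=
  Integrable.of_bound (incr_cont_right x).aestronglyMeasurable 1
    (Eventually.of_forall fun s => abs_incr_le_one x s)

/-- Smoothed drift of a jump law. -/
noncomputable def drift (Q : Measure ℝ) (x : ℝ) : ℝ := ∫ s, incr x s ∂Q

lemma drift_lip (Q : Measure ℝ) [IsProbabilityMeasure Q] (x y : ℝ) :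
    |drift Q x - drift Q y| ≤ 2 * |x - y| := by
  unfold drift
  rw [← integral_sub (incr_integrable_right Q x) (incr_integrable_right Q y)]
  have := norm_integral_le_of_norm_le_const (μ := Q) (f := fun s => incr x s - incr y s)
    (C := 2 * |x - y|) (Eventually.of_forall fun s => incr_lip x y s)
  simpa using this

lemma drift_cont (Q : Measure ℝ) [IsProbabilityMeasure Q] : Continuous (drift Q) := by
  have : LipschitzWith 2 (drift Q) := LipschitzWith.of_dist_le_mul fun x y => by
    simpa [Real.dist_eq] using drift_lip Q x y
  exact this.continuous

lemma abs_drift_le (Q : Measure ℝ) [IsProbabilityMeasure Q] {x a : ℝ} (h : a < |x| - 1) :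
    |drift Q x| ≤ Q.real {s : ℝ | a < |s|} := by
  have hm : MeasurableSet {s : ℝ | a < |s|} := measurableSet_lt measurable_const (by fun_prop)
  unfold drift
  refine (abs_integral_le_integral_abs).trans ?_
  refine (integral_mono (g := Set.indicator {s : ℝ | a < |s|} (fun _ => (1 : ℝ)))
    (incr_integrable_right Q x).abs ((integrable_const 1).indicator hm)
    (fun s => abs_incr_le_ind h)).trans ?_
  rw [integral_indicator_const _ hm]; simp

lemma abs_drift_le_one (Q : Measure ℝ) [IsProbabilityMeasure Q] (x : ℝ) :
    |drift Q x| ≤ 1 := by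
  unfold drift
  have := norm_integral_le_of_norm_le_const (μ := Q) (f := incr x)
    (C := 1) (Eventually.of_forall fun s => abs_incr_le_one x s)
  simpa using this

lemma incr_compact (s : ℝ) : HasCompactSupport (fun x => incr x s) := by
  refine HasCompactSupport.of_support_subset_isCompact
    (isCompact_Icc (a := -(|s| + 1)) (b := |s| + 1)) ?_
  intro x hx
  rw [Function.mem_support] at hx
  by_contra h
  apply hx
  apply incr_eq_zero
  by_contra h2
  exact h (abs_le.mp (by linarith))

lemma integral_incr (s : ℝ) : ∫ x, incr x s = s := by
  set R := |s| + 1 with hR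
  have h1 : ∫ x, incr x s = ∫ x in (-R)..R, incr x s := by
    rw [intervalIntegral.integral_of_le (by rw [hR]; linarith [abs_nonneg s]),
      setIntegral_eq_integral_of_forall_compl_eq_zero]
    intro x hx
    have hx' : ¬ (-R < x ∧ x ≤ R) := hx
    unfold incr
    rcases abs_le.mp (le_refl |s|) with ⟨ha, hb⟩
    by_cases h : -R < x
    · have : R < x := by by_contra h'; exact hx' ⟨h, by linarith⟩
      rw [ramp_of_one_le (by linarith [abs_nonneg s]), ramp_of_one_le (by linarith)]; simp
    · rw [ramp_of_nonpos (by linarith [abs_nonneg s]), ramp_of_nonpos (by linarith)]; simp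
  have hI : ∀ a b : ℝ, IntervalIntegrable ramp volume a b :=
    fun a b => ramp_cont.intervalIntegrable a b
  rw [h1]
  unfold incr
  rw [intervalIntegral.integral_sub (hI _ _)
    (Continuous.intervalIntegrable (u := fun x => ramp (x + s))
      (ramp_cont.comp (continuous_add_const s)) _ _),
    intervalIntegral.integral_comp_add_right (fun x => ramp x) s,
    intervalIntegral.integral_interval_sub_interval_comm (hI _ _) (hI _ _) (hI _ _)]
  have e1 : ∫ x in (-R)..(-R + s), ramp x = s := by
    rw [intervalIntegral.integral_congr (g := fun _ => (1 : ℝ))]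
    · simp
    · intro x hx
      apply ramp_of_nonpos
      rcases Set.mem_uIcc.mp hx with h | h <;> linarith [h.2, le_abs_self s, abs_nonneg s]
  have e2 : ∫ x in R..(R + s), ramp x = 0 := by
    rw [intervalIntegral.integral_congr (g := fun _ => (0 : ℝ))]
    · simp
    · intro x hx
      apply ramp_of_one_le
      rcases Set.mem_uIcc.mp hx with h | h <;> linarith [h.1, neg_abs_le s, abs_nonneg s]
  rw [e1, e2, sub_zero]

lemma integral_abs_incr (s : ℝ) : ∫ x, |incr x s| = |s| := by
  rcases le_total 0 s with h | h
  · rw [abs_of_nonneg h]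
    conv_rhs => rw [← integral_incr s]
    congr 1; ext x
    exact abs_of_nonneg (sub_nonneg.mpr (ramp_anti (by linarith)))
  · rw [abs_of_nonpos h]
    conv_rhs => rw [← integral_incr s]
    rw [← integral_neg]
    congr 1; ext x
    exact abs_of_nonpos (sub_nonpos.mpr (ramp_anti (by linarith)))

lemma incr_prod_integrable (F : Measure ℝ) [IsProbabilityMeasure F]
    (hF : Integrable (fun s : ℝ => s) F) :
    Integrable (Function.uncurry incr) ((volume : Measure ℝ).prod F) := by
  have hc : Continuous (Function.uncurry incr) := incr_cont
  rw [integrable_prod_iff' hc.aestronglyMeasurable]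
  refine ⟨Eventually.of_forall fun s =>
    (incr_cont_left s).integrable_of_hasCompactSupport (incr_compact s), ?_⟩
  simp only [Function.uncurry, Real.norm_eq_abs, integral_abs_incr]
  exact hF.abs

lemma integral_drift (F : Measure ℝ) [IsProbabilityMeasure F]
    (hF : Integrable (fun s : ℝ => s) F) : ∫ x, drift F x = ∫ s, s ∂F := by
  unfold drift
  rw [integral_integral_swap (incr_prod_integrable F hF)]
  simp [integral_incr]

/-- Partition of unity. -/
noncomputable def bump (j : ℤ) (x : ℝ) : ℝ := ramp (x - j - 1) - ramp (x - j)

lemma bump_cont (j : ℤ) : Continuous (bump j) := by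
  unfold bump
  exact (ramp_cont.comp (by fun_prop)).sub (ramp_cont.comp (by fun_prop))

lemma bump_nonneg (j : ℤ) (x : ℝ) : 0 ≤ bump j x := sub_nonneg.mpr (ramp_anti (by linarith))

lemma bump_le_one (j : ℤ) (x : ℝ) : bump j x ≤ 1 := by
  unfold bump; linarith [ramp_le_one (x - j - 1), ramp_nonneg (x - j)]

lemma bump_zero {j : ℤ} {x : ℝ} (h : x ∉ Set.Icc (j : ℝ) (j + 2)) : bump j x = 0 := by
  unfold bump
  by_cases h1 : x < j
  · rw [ramp_of_nonpos (by linarith), ramp_of_nonpos (by linarith)]; simp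
  · have : (j : ℝ) + 2 < x := by by_contra h'; exact h ⟨by linarith, by linarith⟩
    rw [ramp_of_one_le (by linarith), ramp_of_one_le (by linarith)]; simp

lemma bump_hasSum (x : ℝ) : HasSum (fun j : ℤ => bump j x) 1 := by
  have hs : ∑ j ∈ ({⌊x⌋ - 1, ⌊x⌋} : Finset ℤ), bump j x = 1 := by
    rw [Finset.sum_pair (by omega)]
    unfold bump
    have h1 := Int.floor_le x
    have h2 := Int.lt_floor_add_one x
    push_cast
    rw [ramp_of_one_le (x := x - (⌊x⌋ - 1)) (by linarith),
      ramp_of_nonpos (x := x - ⌊x⌋ - 1) (by linarith)]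
    ring_nf
  rw [← hs]
  apply hasSum_sum_of_ne_finset_zero
  intro j hj
  simp only [Finset.mem_insert, Finset.mem_singleton, not_or] at hj
  have h1 := Int.floor_le x
  have h2 := Int.lt_floor_add_one x
  unfold bump
  rcases lt_or_ge j (⌊x⌋ - 1) with h | h
  · have : (j : ℝ) + 2 ≤ ⌊x⌋ := by exact_mod_cast (by omega : j + 2 ≤ ⌊x⌋)
    rw [ramp_of_one_le (by linarith), ramp_of_one_le (by linarith)]; simp
  · have : (⌊x⌋ : ℝ) + 1 ≤ j := by exact_mod_cast (by omega : ⌊x⌋ + 1 ≤ j)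
    rw [ramp_of_nonpos (by linarith), ramp_of_nonpos (by linarith)]; simp

lemma tail_summable (Q : Measure ℝ) [IsProbabilityMeasure Q]
    (hQ : Integrable (fun s : ℝ => |s|) Q) :
    Summable (fun j : ℤ => Q.real {s : ℝ | |(j : ℝ)| - 4 < |s|}) := by
  have h0 : Summable (fun n : ℕ => Q.real {s : ℝ | (n : ℝ) < |s|}) := by
    let _ : MeasureSpace ℝ := ⟨Q⟩
    have := tsum_prob_mem_Ioi_lt_top (Ω := ℝ) (X := fun s => |s|) hQ (fun s => abs_nonneg s)
    exact ENNReal.summable_toReal this.ne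
  have h1 : Summable (fun n : ℕ => Q.real {s : ℝ | (n : ℝ) - 4 < |s|}) := by
    rw [← summable_nat_add_iff 4]
    simpa using h0
  apply Summable.of_nat_of_neg
  · simpa using h1
  · simpa using h1

end BalanceAux

namespace BalanceAux

lemma meas_Icc_le (V : Measure ℝ) (C : NNReal)
    (hV : ∀ k : ℤ, V (Set.Ioc (k : ℝ) (k + 1)) ≤ C) (a : ℝ) :
    V (Set.Icc a (a + 2)) ≤ ((4 * C : NNReal) : ENNReal) := by
  set k : ℤ := ⌈a⌉ - 1 with hk
  have h1 : (k : ℝ) < a := by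
    have := Int.ceil_lt_add_one a
    rw [hk]; push_cast; linarith
  have h2 : a ≤ k + 1 := by
    have := Int.le_ceil a
    rw [hk]; push_cast; linarith
  have hsub : Set.Icc a (a + 2) ⊆
      ((Set.Ioc (k : ℝ) (k + 1) ∪ Set.Ioc ((k + 1 : ℤ) : ℝ) ((k + 1 : ℤ) + 1)) ∪
        Set.Ioc ((k + 2 : ℤ) : ℝ) ((k + 2 : ℤ) + 1)) ∪
        Set.Ioc ((k + 3 : ℤ) : ℝ) ((k + 3 : ℤ) + 1) := by
    intro x hx
    obtain ⟨hx1, hx2⟩ := hx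
    simp only [Set.mem_union, Set.mem_Ioc]
    push_cast
    by_cases c1 : x ≤ k + 1
    · exact Or.inl (Or.inl (Or.inl ⟨by linarith, c1⟩))
    by_cases c2 : x ≤ k + 2
    · exact Or.inl (Or.inl (Or.inr ⟨by linarith, by linarith⟩))
    by_cases c3 : x ≤ k + 3
    · exact Or.inl (Or.inr ⟨by linarith, by linarith⟩)
    · exact Or.inr ⟨by linarith, by linarith⟩
  calc V (Set.Icc a (a + 2)) ≤ _ := measure_mono hsub
    _ ≤ ((C + C) + C) + C := by
        refine (measure_union_le _ _).trans (add_le_add ?_ (hV _))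
        refine (measure_union_le _ _).trans (add_le_add ?_ (hV _))
        exact (measure_union_le _ _).trans (add_le_add (hV _) (hV _))
    _ = _ := by push_cast; ring

lemma local_bound (V : Measure ℝ) (C : NNReal)
    (hV : ∀ k : ℤ, V (Set.Ioc (k : ℝ) (k + 1)) ≤ C) (a b : ℝ) (hb : 0 ≤ b)
    (g : ℝ → ℝ) (hg : Measurable g) (h1 : ∀ y ∈ Set.Icc a (a + 2), |g y| ≤ b)
    (h0 : ∀ y, y ∉ Set.Icc a (a + 2) → g y = 0) :
    Integrable g V ∧ ∫ y, |g y| ∂V ≤ b * (4 * C) := by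
  have hfin := meas_Icc_le V C hV a
  have hlt : V (Set.Icc a (a + 2)) < ⊤ := lt_of_le_of_lt hfin ENNReal.coe_lt_top
  have hi : Integrable (Set.indicator (Set.Icc a (a + 2)) (fun _ => b)) V :=
    (integrable_indicator_iff measurableSet_Icc).mpr (integrableOn_const hlt.ne)
  have hle : ∀ y, |g y| ≤ Set.indicator (Set.Icc a (a + 2)) (fun _ => b) y := by
    intro y
    by_cases hy : y ∈ Set.Icc a (a + 2)
    · rw [Set.indicator_of_mem hy]; exact h1 y hy
    · rw [Set.indicator_of_notMem hy, h0 y hy]; simp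
  have hgi : Integrable g V :=
    hi.mono' hg.aestronglyMeasurable (Eventually.of_forall hle)
  refine ⟨hgi, ?_⟩
  refine (integral_mono hgi.abs hi hle).trans ?_
  rw [integral_indicator_const _ measurableSet_Icc, smul_eq_mul, mul_comm]
  refine mul_le_mul_of_nonneg_left ?_ hb
  have := ENNReal.toReal_mono ENNReal.coe_ne_top hfin
  simpa [Measure.real] using this

lemma integrable_of_unit_bound (V : Measure ℝ) (C : NNReal)
    (hV : ∀ k : ℤ, V (Set.Ioc (k : ℝ) (k + 1)) ≤ C) (B : ℤ → ℝ) (hB : Summable B)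
    (g : ℝ → ℝ) (hg : Measurable g)
    (h1 : ∀ j : ℤ, ∀ y ∈ Set.Ioc (j : ℝ) (j + 1), |g y| ≤ B j) : Integrable g V := by
  refine ⟨hg.aestronglyMeasurable, ?_⟩
  have hB0 : ∀ j, 0 ≤ B j := fun j =>
    (abs_nonneg _).trans (h1 j (j + 1) ⟨by linarith, le_rfl⟩)
  unfold HasFiniteIntegral
  rw [← setLIntegral_univ, ← iUnion_Ioc_intCast ℝ]
  refine lt_of_le_of_lt (lintegral_iUnion_le _ _) ?_
  have hle : ∀ j : ℤ, ∫⁻ y in Set.Ioc (j : ℝ) (j + 1), ‖g y‖ₑ ∂V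
      ≤ ENNReal.ofReal (B j) * C := by
    intro j
    calc ∫⁻ y in Set.Ioc (j : ℝ) (j + 1), ‖g y‖ₑ ∂V
        ≤ ∫⁻ y in Set.Ioc (j : ℝ) (j + 1), ENNReal.ofReal (B j) ∂V := by
          refine setLIntegral_mono measurable_const fun y hy => ?_
          rw [← ofReal_norm]
          exact ENNReal.ofReal_le_ofReal (h1 j y hy)
      _ = ENNReal.ofReal (B j) * V (Set.Ioc (j : ℝ) (j + 1)) := by simp
      _ ≤ _ := by gcongr; exact hV j
  refine lt_of_le_of_lt (ENNReal.tsum_le_tsum hle) ?_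
  rw [ENNReal.tsum_mul_right]
  exact ENNReal.mul_lt_top hB.tsum_ofReal_lt_top ENNReal.coe_lt_top

lemma drift_unif (Q : ℝ → Measure ℝ) [∀ y, IsProbabilityMeasure (Q y)]
    (F : Measure ℝ) [IsProbabilityMeasure F]
    (hweak : ∀ f : BoundedContinuousFunction ℝ ℝ,
      Tendsto (fun x : ℝ => ∫ s, f s ∂(Q x)) atTop (nhds (∫ s, f s ∂F)))
    (a b ε : ℝ) (hε : 0 < ε) :
    ∀ᶠ y in atTop, ∀ x ∈ Set.Icc a b, |drift (Q y) x - drift F x| ≤ ε := by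
  refine (isCompact_Icc (a := a) (b := b)).induction_on
    (p := fun S => ∀ᶠ y in atTop, ∀ x ∈ S, |drift (Q y) x - drift F x| ≤ ε) ?_ ?_ ?_ ?_
  · simp
  · intro s t hst h
    filter_upwards [h] with y hy x hx using hy x (hst hx)
  · intro s t hs ht
    filter_upwards [hs, ht] with y h1 h2 x hx
    exact hx.elim (h1 x) (h2 x)
  · intro x _
    refine ⟨Metric.ball x (ε / 8), mem_nhdsWithin_of_mem_nhds (Metric.ball_mem_nhds x (by linarith)), ?_⟩
    have hx := hweak (BoundedContinuousFunction.ofNormedAddCommGroup (incr x) (incr_cont_right x) 1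
      (fun s => abs_incr_le_one x s))
    have hx' : Tendsto (fun y => drift (Q y) x) atTop (nhds (drift F x)) := hx
    filter_upwards [Metric.tendsto_nhds.mp hx' (ε / 4) (by linarith)] with y hy z hz
    rw [Real.dist_eq] at hy
    rw [Metric.mem_ball, Real.dist_eq] at hz
    have a1 := abs_le.mp ((drift_lip (Q y) z x))
    have a2 := abs_le.mp ((drift_lip F z x))
    have a3 := abs_lt.mp hy
    rw [abs_le]; constructor <;> linarith [a1.1, a1.2, a2.1, a2.2, a3.1, a3.2]

section limit

variable (Q : ℝ → Measure ℝ) [∀ y, IsProbabilityMeasure (Q y)]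

lemma term_bound (V : Measure ℝ) (C : NNReal)
    (hV : ∀ k : ℤ, V (Set.Ioc (k : ℝ) (k + 1)) ≤ C)
    (B : ℤ → ℝ) (hQB : ∀ y, ∀ j : ℤ, (Q y).real {s : ℝ | |(j : ℝ)| - 4 < |s|} ≤ B j)
    (t : ℝ) (hm : Measurable fun y => drift (Q y) (y - t)) (j : ℤ) :
    Integrable (fun y => drift (Q y) (y - t) * bump j (y - t)) V ∧
    ∫ y, |drift (Q y) (y - t) * bump j (y - t)| ∂V ≤ B j * (4 * C) := by
  refine local_bound V C hV (t + j) (B j) (measureReal_nonneg.trans (hQB 0 j)) _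
    (hm.mul ((bump_cont j).measurable.comp (measurable_id.sub_const t))) ?_ ?_
  · intro y hy
    rw [abs_mul, abs_of_nonneg (bump_nonneg _ _)]
    have hlt : |(j : ℝ)| - 4 < |y - t| - 1 := by
      have h3 : |(j : ℝ) - (y - t)| ≤ 2 := by
        rw [abs_le]; constructor <;> linarith [hy.1, hy.2]
      have := abs_sub_abs_le_abs_sub (j : ℝ) (y - t)
      linarith
    have h2 := (abs_drift_le (Q y) hlt).trans (hQB y j)
    nlinarith [abs_nonneg (drift (Q y) (y - t)), bump_nonneg j (y - t), bump_le_one j (y - t)]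
  · intro y hy
    rw [bump_zero, mul_zero]
    intro h
    exact hy ⟨by linarith [h.1], by linarith [h.2]⟩

lemma drift_hasSum (V : Measure ℝ) (C : NNReal)
    (hV : ∀ k : ℤ, V (Set.Ioc (k : ℝ) (k + 1)) ≤ C)
    (B : ℤ → ℝ) (hB : Summable B)
    (hQB : ∀ y, ∀ j : ℤ, (Q y).real {s : ℝ | |(j : ℝ)| - 4 < |s|} ≤ B j)
    (t : ℝ) (hm : Measurable fun y => drift (Q y) (y - t)) :
    HasSum (fun j : ℤ => ∫ y, drift (Q y) (y - t) * bump j (y - t) ∂V)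
      (∫ y, drift (Q y) (y - t) ∂V) := by
  have h := hasSum_integral_of_summable_integral_norm (μ := V)
    (F := fun (j : ℤ) y => drift (Q y) (y - t) * bump j (y - t))
    (fun j => (term_bound Q V C hV B hQB t hm j).1)
    (Summable.of_nonneg_of_le (fun j => integral_nonneg fun y => norm_nonneg _)
      (fun j => (term_bound Q V C hV B hQB t hm j).2) (hB.mul_right _))
  have he : ∀ y, ∑' j : ℤ, drift (Q y) (y - t) * bump j (y - t) = drift (Q y) (y - t) := by
    intro y
    rw [tsum_mul_left, (bump_hasSum _).tsum_eq, mul_one]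
  simpa only [he] using h

lemma drift_limit (F : Measure ℝ) [IsProbabilityMeasure F]
    (hweak : ∀ f : BoundedContinuousFunction ℝ ℝ,
      Tendsto (fun x : ℝ => ∫ s, f s ∂(Q x)) atTop (nhds (∫ s, f s ∂F)))
    (hF : Integrable (fun s : ℝ => s) F)
    (V : Measure ℝ) (C : NNReal)
    (hV : ∀ k : ℤ, V (Set.Ioc (k : ℝ) (k + 1)) ≤ C)
    (B : ℤ → ℝ) (hB : Summable B)
    (hQB : ∀ y, ∀ j : ℤ, (Q y).real {s : ℝ | |(j : ℝ)| - 4 < |s|} ≤ B j)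
    (hm : ∀ t, Measurable fun y => drift (Q y) (y - t))
    (t : ℕ → ℝ) (ht : Tendsto t atTop atTop) (α : ℝ)
    (hconv : ∀ f : ℝ → ℝ, Continuous f → HasCompactSupport f →
      Tendsto (fun n : ℕ => ∫ y, f (y - t n) ∂V) atTop (nhds (α * ∫ x, f x))) :
    Tendsto (fun n => ∫ y, drift (Q y) (y - t n) ∂V) atTop (nhds (α * ∫ s, s ∂F)) := by
  have hvol : HasSum (fun j : ℤ => α * ∫ x, drift F x * bump j x) (α * ∫ s, s ∂F) := by
    have hv : ∀ k : ℤ, (volume : Measure ℝ) (Set.Ioc (k : ℝ) (k + 1)) ≤ ((1 : NNReal) : ENNReal) := by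
      intro k; simp
    have := drift_hasSum (fun _ => F) volume 1 hv _ (tail_summable F hF.abs)
      (fun _ j => le_rfl) 0 (by simpa using (drift_cont F).measurable)
    simp only [sub_zero, integral_drift F hF] at this
    exact this.mul_left α
  have hsum := fun n => (drift_hasSum Q V C hV B hB hQB (t n) (hm _)).tsum_eq
  rw [← hvol.tsum_eq]
  simp only [← hsum]
  refine tendsto_tsum_of_dominated_convergence (bound := fun j => B j * (4 * C))
    (hB.mul_right _) ?_ ?_
  · intro j
    have hcs : HasCompactSupport (fun x => drift F x * bump j x) := by
      refine HasCompactSupport.of_support_subset_isCompact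
        (isCompact_Icc (a := (j : ℝ)) (b := j + 2)) ?_
      intro x hx
      by_contra h
      exact hx (by simp [bump_zero h])
    have hc : Continuous (fun x => drift F x * bump j x) := (drift_cont F).mul (bump_cont j)
    have hlim := hconv _ hc hcs
    have hdiff : Tendsto (fun n => ∫ y, drift (Q y) (y - t n) * bump j (y - t n) ∂V -
        ∫ y, drift F (y - t n) * bump j (y - t n) ∂V) atTop (nhds 0) := by
      rw [Metric.tendsto_nhds]
      intro ε hε
      set δ : ℝ := ε / (2 * (4 * C + 1)) with hδ
      have hpos : (0 : ℝ) < 4 * C + 1 := by positivity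
      have hδ0 : 0 < δ := by positivity
      have hu := drift_unif Q F hweak j (j + 2) δ hδ0
      obtain ⟨Y, hY⟩ := eventually_atTop.mp hu
      filter_upwards [ht.eventually_ge_atTop (Y - j)] with n hn
      have i1 := (term_bound Q V C hV B hQB (t n) (hm _) j).1
      have i2 := (term_bound (fun _ => F) V C hV _ (fun _ j => le_rfl) (t n)
        ((drift_cont F).measurable.comp (measurable_id.sub_const _)) j).1
      rw [← integral_sub i1 i2]
      have := (local_bound V C hV (t n + j) δ hδ0.le
        (fun y => drift (Q y) (y - t n) * bump j (y - t n) - drift F (y - t n) * bump j (y - t n))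
        (((hm _).mul ((bump_cont j).measurable.comp (measurable_id.sub_const _))).sub
          (hc.measurable.comp (measurable_id.sub_const _))) ?_ ?_).2
      · rw [dist_zero_right]
        refine lt_of_le_of_lt ((norm_integral_le_integral_norm _).trans this) ?_
        calc δ * (4 * C) ≤ δ * (4 * C + 1) := by gcongr; linarith
          _ = ε / 2 := by rw [hδ]; field_simp
          _ < ε := by linarith
      · intro y hy
        rw [← sub_mul, abs_mul, abs_of_nonneg (bump_nonneg _ _)]
        have h2 := hY y (by linarith [hy.1]) (y - t n) ⟨by linarith [hy.1], by linarith [hy.2]⟩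
        nlinarith [abs_nonneg (drift (Q y) (y - t n) - drift F (y - t n)), bump_nonneg j (y - t n),
          bump_le_one j (y - t n)]
      · intro y hy
        rw [bump_zero]
        · simp
        intro h
        exact hy ⟨by linarith [h.1], by linarith [h.2]⟩
    have := hdiff.add hlim
    simpa using this
  · refine Eventually.of_forall fun n j => ?_
    exact (norm_integral_le_integral_norm _).trans (term_bound Q V C hV B hQB (t n) (hm _) j).2

end limit

end BalanceAux

namespace BalanceAux

lemma chainDist_succ' (P : Kernel ℝ ℝ) (μ0 : Measure ℝ) (n : ℕ) :
    chainDist P μ0 (n + 1) = chainDist P (μ0.bind P) n := by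
  induction n with
  | zero => rfl
  | succ n ih =>
    change (chainDist P μ0 (n + 1)).bind P = _
    rw [ih]; rfl

lemma chainDist_prob (P : Kernel ℝ ℝ) [IsMarkovKernel P] (μ0 : Measure ℝ)
    [IsProbabilityMeasure μ0] (n : ℕ) : IsProbabilityMeasure (chainDist P μ0 n) := by
  induction n with
  | zero => assumption
  | succ n ih =>
    change IsProbabilityMeasure ((chainDist P μ0 n).bind P)
    infer_instance

lemma renewal_succ (P : Kernel ℝ ℝ) (μ0 : Measure ℝ) :
    renewalMeasure P μ0 = μ0 + renewalMeasure P (μ0.bind P) := by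
  ext s hs
  unfold renewalMeasure
  rw [Measure.sum_apply _ hs, Measure.add_apply, Measure.sum_apply _ hs,
    tsum_eq_zero_add' ENNReal.summable]
  simp only [chainDist_succ']
  rfl

lemma renewal_bind (P : Kernel ℝ ℝ) (μ0 : Measure ℝ) :
    renewalMeasure P (μ0.bind P) = (renewalMeasure P μ0).bind P := by
  ext s hs
  unfold renewalMeasure
  rw [Measure.sum_apply _ hs, Measure.bind_apply hs P.measurable.aemeasurable,
    lintegral_sum_measure]
  simp only [← chainDist_succ']
  refine tsum_congr fun n => ?_
  change ((chainDist P μ0 n).bind P) s = _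
  rw [Measure.bind_apply hs P.measurable.aemeasurable]

lemma renewalTail_succ (P : Kernel ℝ ℝ) (μ0 : Measure ℝ) (k : ℕ) :
    renewalTail P μ0 (k + 1) = renewalTail P (μ0.bind P) k := by
  unfold renewalTail
  congr 1; ext1 j
  rw [show k + 1 + j = (k + j) + 1 by ring, chainDist_succ']

lemma renewalTail_zero (P : Kernel ℝ ℝ) (μ0 : Measure ℝ) :
    renewalTail P μ0 0 = renewalMeasure P μ0 := by
  unfold renewalTail renewalMeasure
  simp

instance jumpLaw_prob (P : Kernel ℝ ℝ) [IsMarkovKernel P] (y : ℝ) :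
    IsProbabilityMeasure (jumpLaw P y) :=
  Measure.isProbabilityMeasure_map (measurable_id.sub_const y).aemeasurable

lemma ramp_int (μ : Measure ℝ) [IsFiniteMeasure μ] (t : ℝ) :
    Integrable (fun z => ramp (z - t)) μ :=
  Integrable.of_bound (ramp_cont.comp (continuous_sub_right t)).aestronglyMeasurable 1
    (Eventually.of_forall fun z => by
      rw [Real.norm_eq_abs, abs_of_nonneg (ramp_nonneg _)]; exact ramp_le_one _)

lemma drift_jump (P : Kernel ℝ ℝ) [IsMarkovKernel P] (y t : ℝ) :
    drift (jumpLaw P y) (y - t) = ramp (y - t) - ∫ z, ramp (z - t) ∂(P y) := by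
  unfold drift jumpLaw
  rw [integral_map (φ := fun z => z - y) (measurable_id.sub_const y).aemeasurable
    (incr_cont_right _).aestronglyMeasurable]
  unfold incr
  have : ∀ z, y - t + (z - y) = z - t := fun z => by ring
  simp only [this]
  rw [integral_sub (integrable_const _) (ramp_int _ t)]
  simp

lemma drift_jump_meas (P : Kernel ℝ ℝ) [IsMarkovKernel P] (t : ℝ) :
    Measurable fun y => drift (jumpLaw P y) (y - t) := by
  simp only [drift_jump]
  refine (ramp_cont.measurable.comp (measurable_id.sub_const t)).sub ?_
  have hs : StronglyMeasurable (fun z => ramp (z - t)) :=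
    (ramp_cont.comp (continuous_sub_right t)).stronglyMeasurable
  exact (hs.integral_kernel (κ := P)).measurable

lemma jump_bound (P : Kernel ℝ ℝ) [IsMarkovKernel P] (B : ℤ → ℝ)
    (hQB : ∀ y, ∀ j : ℤ, (jumpLaw P y).real {s : ℝ | |(j : ℝ)| - 4 < |s|} ≤ B j)
    (j : ℤ) (y : ℝ) (hy : y ∈ Set.Ioc (j : ℝ) (j + 1)) (S : Set ℝ)
    (hS : ∀ z ∈ S, |y| ≤ |z - y|) : (P y).real S ≤ B j := by
  refine le_trans ?_ (hQB y j)
  have hm : MeasurableSet {s : ℝ | |(j : ℝ)| - 4 < |s|} :=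
    measurableSet_lt measurable_const (by fun_prop)
  unfold jumpLaw
  rw [map_measureReal_apply (f := fun z => z - y) (measurable_id.sub_const y) hm]
  refine measureReal_mono ?_
  intro z hz
  have h1 := hS z hz
  have h3 : |(j : ℝ) - y| ≤ 1 := by
    rw [abs_le]; constructor <;> linarith [hy.1, hy.2]
  have := abs_sub_abs_le_abs_sub (j : ℝ) y
  change |(j : ℝ)| - 4 < |z - y|
  linarith

lemma integral_bind_eq (P : Kernel ℝ ℝ) [IsMarkovKernel P] (V : Measure ℝ)
    (f : ℝ → ℝ) (hf : Integrable f (V.bind P)) :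
    Integrable (fun y => ∫ z, f z ∂(P y)) V ∧
      ∫ z, f z ∂(V.bind P) = ∫ y, ∫ z, f z ∂(P y) ∂V := by
  rw [Measure.comp_eq_comp_const_apply] at hf ⊢
  refine ⟨?_, ?_⟩
  · simpa using hf.integral_comp
  · rw [Kernel.integral_comp hf]; simp

lemma balance_zero
    (P : Kernel ℝ ℝ) [IsMarkovKernel P]
    (μ0 : Measure ℝ) [IsProbabilityMeasure μ0]
    (F : Measure ℝ) [IsProbabilityMeasure F]
    (hweak : ∀ f : BoundedContinuousFunction ℝ ℝ,
      Tendsto (fun x : ℝ => ∫ s, f s ∂(jumpLaw P x)) atTop (nhds (∫ s, f s ∂F)))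
    (hF : Integrable (fun s : ℝ => s) F)
    (C : NNReal)
    (hV : ∀ k : ℤ, renewalMeasure P μ0 (Set.Ioc (k : ℝ) (k + 1)) ≤ C)
    (B : ℤ → ℝ) (hB : Summable B)
    (hQB : ∀ y, ∀ j : ℤ, (jumpLaw P y).real {s : ℝ | |(j : ℝ)| - 4 < |s|} ≤ B j)
    (t : ℕ → ℝ) (ht : Tendsto t atTop atTop) (α : ℝ)
    (hconv : ∀ f : ℝ → ℝ, Continuous f → HasCompactSupport f →
      Tendsto (fun n : ℕ => ∫ y, f (y - t n) ∂(renewalMeasure P μ0)) atTop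
        (nhds (α * ∫ x, f x))) :
    μ0.real (Set.Ioi (0 : ℝ)) =
        -(∫ y in Set.Iic (0 : ℝ), (P y).real (Set.Ioi (0 : ℝ)) ∂(renewalMeasure P μ0))
          + (∫ y in Set.Ioi (0 : ℝ), (P y).real (Set.Iic (0 : ℝ)) ∂(renewalMeasure P μ0))
          + α * ∫ s, s ∂F := by
  set V := renewalMeasure P μ0 with hVdef
  have hdecomp : V = μ0 + V.bind P := by
    rw [hVdef, ← renewal_bind, ← renewal_succ]
  have hlim := drift_limit (jumpLaw P) F hweak hF V C hV B hB hQB (drift_jump_meas P) t ht α hconv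
  have hB0 : ∀ j, 0 ≤ B j := fun j => measureReal_nonneg.trans (hQB 0 j)
  -- the two boundary functions
  set h1 : ℝ → ℝ := Set.indicator (Set.Iic 0) (fun y => (P y).real (Set.Ioi (0 : ℝ))) with hh1
  set h2 : ℝ → ℝ := Set.indicator (Set.Ioi 0) (fun y => (P y).real (Set.Iic (0 : ℝ))) with hh2
  have m1 : Measurable fun y => (P y).real (Set.Ioi (0 : ℝ)) :=
    (P.measurable_coe measurableSet_Ioi).ennreal_toReal
  have m2 : Measurable fun y => (P y).real (Set.Iic (0 : ℝ)) :=
    (P.measurable_coe measurableSet_Iic).ennreal_toReal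
  have i1 : Integrable h1 V := by
    refine integrable_of_unit_bound V C hV B hB _ (m1.indicator measurableSet_Iic) ?_
    intro j y hy
    by_cases h : y ∈ Set.Iic (0 : ℝ)
    · rw [hh1, Set.indicator_of_mem h, abs_of_nonneg measureReal_nonneg]
      refine jump_bound P B hQB j y hy _ fun z hz => ?_
      have h' : y ≤ 0 := h
      have hz' : 0 < z := hz
      rw [abs_of_nonpos h', abs_of_nonneg (by linarith)]; linarith
    · rw [hh1, Set.indicator_of_notMem h]; simpa using hB0 j
  have i2 : Integrable h2 V := by
    refine integrable_of_unit_bound V C hV B hB _ (m2.indicator measurableSet_Ioi) ?_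
    intro j y hy
    by_cases h : y ∈ Set.Ioi (0 : ℝ)
    · rw [hh2, Set.indicator_of_mem h, abs_of_nonneg measureReal_nonneg]
      refine jump_bound P B hQB j y hy _ fun z hz => ?_
      have h' : 0 < y := h
      have hz' : z ≤ 0 := hz
      rw [abs_of_pos h', abs_of_nonpos (by linarith)]; linarith
    · rw [hh2, Set.indicator_of_notMem h]; simpa using hB0 j
  -- test functions
  let f : ℕ → ℝ → ℝ := fun n y => ramp (y - t n) - Set.indicator (Set.Iic 0) (fun _ => (1 : ℝ)) y
  have fmeas : ∀ n, Measurable (f n) := fun n =>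
    (ramp_cont.measurable.comp (measurable_id.sub_const _)).sub
      (measurable_const.indicator measurableSet_Iic)
  have fabs : ∀ n y, |f n y| ≤ 1 := by
    intro n y
    have a1 := ramp_nonneg (y - t n)
    have a2 := ramp_le_one (y - t n)
    change |ramp (y - t n) - Set.indicator (Set.Iic 0) (fun _ => (1 : ℝ)) y| ≤ 1
    by_cases h : y ∈ Set.Iic (0 : ℝ)
    · rw [Set.indicator_of_mem h, abs_le]; constructor <;> linarith
    · rw [Set.indicator_of_notMem h, abs_le]; constructor <;> linarith
  have fint : ∀ n, 0 ≤ t n → Integrable (f n) V := by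
    intro n hn
    -- finitely many unit intervals
    refine integrable_of_unit_bound V C hV
      (fun j => if j ∈ Finset.Icc (-1 : ℤ) ⌈t n + 1⌉ then 1 else 0)
      (summable_of_ne_finset_zero (s := Finset.Icc (-1 : ℤ) ⌈t n + 1⌉)
        (fun j hj => if_neg hj)) _ (fmeas n) ?_
    intro j y hy
    split_ifs with hj
    · exact fabs n y
    · have : f n y = 0 := by
        change ramp (y - t n) - Set.indicator (Set.Iic 0) (fun _ => (1 : ℝ)) y = 0
        rw [Finset.mem_Icc, not_and_or, not_le, not_le] at hj
        rcases hj with hj | hj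
        · have : (j : ℝ) + 1 ≤ 0 := by exact_mod_cast (by omega : j + 1 ≤ 0)
          have hy0 : y ≤ 0 := by linarith [hy.2]
          rw [ramp_of_nonpos (by linarith), Set.indicator_of_mem (by exact hy0)]; simp
        · have hj' : t n + 1 < j := by linarith [Int.ceil_lt_iff.mp hj]
          have hy0 : ¬ y ≤ 0 := by linarith [hy.1]
          rw [ramp_of_one_le (by linarith [hy.1]), Set.indicator_of_notMem (by exact hy0)]; simp
      rw [this]; simp
  have key : ∀ n, 0 ≤ t n → ∫ y, f n y ∂μ0 =
      ∫ y, drift (jumpLaw P y) (y - t n) ∂V + (∫ y, h2 y ∂V - ∫ y, h1 y ∂V) := by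
    intro n hn
    have hi := fint n hn
    have hi' : Integrable (f n) (μ0 + V.bind P) := by rw [← hdecomp]; exact hi
    rw [integrable_add_measure] at hi'
    have hb := integral_bind_eq P V (f n) hi'.2
    have e1 : ∫ y, f n y ∂V = ∫ y, f n y ∂μ0 + ∫ y, ∫ z, f n z ∂(P y) ∂V := by
      rw [← hb.2, ← integral_add_measure hi'.1 hi'.2, ← hdecomp]
    have e2 : ∀ y, drift (jumpLaw P y) (y - t n) =
        (f n y - ∫ z, f n z ∂(P y)) - (h2 y - h1 y) := by
      intro y
      rw [drift_jump]
      have e3 : ∫ z, f n z ∂(P y) = ∫ z, ramp (z - t n) ∂(P y) - (P y).real (Set.Iic 0) := by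
        change ∫ z, (ramp (z - t n) - Set.indicator (Set.Iic 0) (fun _ => (1 : ℝ)) z) ∂(P y) = _
        rw [integral_sub (ramp_int _ _) ((integrable_const _).indicator measurableSet_Iic),
          integral_indicator_const _ measurableSet_Iic]
        simp
      have e4 : (P y).real (Set.Ioi 0) = 1 - (P y).real (Set.Iic 0) := by
        rw [← Set.compl_Iic, probReal_compl_eq_one_sub measurableSet_Iic]
      rw [e3]
      change _ = (ramp (y - t n) - Set.indicator (Set.Iic 0) (fun _ => (1 : ℝ)) y - _) - _
      rw [hh1, hh2]
      by_cases h : y ≤ 0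
      · simp only [Set.indicator, Set.mem_Iic, Set.mem_Ioi, h, not_lt.mpr h, if_true, if_false, e4]
        ring
      · simp only [Set.indicator, Set.mem_Iic, Set.mem_Ioi, h, not_le.mp h, if_true, if_false]
        ring
    have e5 : ∫ y, drift (jumpLaw P y) (y - t n) ∂V =
        (∫ y, f n y ∂V - ∫ y, ∫ z, f n z ∂(P y) ∂V) - (∫ y, h2 y ∂V - ∫ y, h1 y ∂V) := by
      simp only [e2]
      rw [integral_sub (f := fun y => f n y - ∫ z, f n z ∂(P y)) (g := fun y => h2 y - h1 y)
        (hi.sub hb.1) (i2.sub i1), integral_sub hi hb.1, integral_sub i2 i1]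
    linarith
  have hleft : Tendsto (fun n => ∫ y, f n y ∂μ0) atTop (nhds (μ0.real (Set.Ioi 0))) := by
    have : μ0.real (Set.Ioi 0) = ∫ y, Set.indicator (Set.Ioi 0) (fun _ => (1 : ℝ)) y ∂μ0 := by
      rw [integral_indicator_const _ measurableSet_Ioi]; simp
    rw [this]
    refine tendsto_integral_of_dominated_convergence (fun _ => (1 : ℝ))
      (fun n => (fmeas n).aestronglyMeasurable) (integrable_const _)
      (fun n => Eventually.of_forall (fabs n)) (Eventually.of_forall fun y => ?_)
    refine tendsto_const_nhds.congr' ?_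
    filter_upwards [ht.eventually_ge_atTop y] with n hn
    change _ = ramp (y - t n) - Set.indicator (Set.Iic 0) (fun _ => (1 : ℝ)) y
    rw [ramp_of_nonpos (by linarith)]
    by_cases h : y ≤ 0
    · simp [Set.indicator, h, not_lt.mpr h]
    · simp [Set.indicator, h, not_le.mp h]
  have hright : Tendsto (fun n => ∫ y, f n y ∂μ0) atTop
      (nhds (α * ∫ s, s ∂F + (∫ y, h2 y ∂V - ∫ y, h1 y ∂V))) := by
    refine (hlim.add_const _).congr' ?_
    filter_upwards [ht.eventually_ge_atTop 0] with n hn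
    exact (key n hn).symm
  rw [tendsto_nhds_unique hleft hright, hh1, hh2, integral_indicator measurableSet_Iic,
    integral_indicator measurableSet_Ioi]
  ring

lemma conv_step (P : Kernel ℝ ℝ) [IsMarkovKernel P]
    (μ0 : Measure ℝ) [IsProbabilityMeasure μ0] (C : NNReal)
    (hV : ∀ k : ℤ, renewalMeasure P μ0 (Set.Ioc (k : ℝ) (k + 1)) ≤ C)
    (t : ℕ → ℝ) (ht : Tendsto t atTop atTop) (α : ℝ)
    (hconv : ∀ f : ℝ → ℝ, Continuous f → HasCompactSupport f →
      Tendsto (fun n : ℕ => ∫ y, f (y - t n) ∂(renewalMeasure P μ0)) atTop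
        (nhds (α * ∫ x, f x)))
    (f : ℝ → ℝ) (hf : Continuous f) (hc : HasCompactSupport f) :
    Tendsto (fun n : ℕ => ∫ y, f (y - t n) ∂(renewalMeasure P (μ0.bind P))) atTop
        (nhds (α * ∫ x, f x)) := by
  obtain ⟨M, hM⟩ := hc.exists_bound_of_continuous hf
  have hfc : ∀ n, Continuous fun y => f (y - t n) := fun n => hf.comp (continuous_sub_right _)
  have : IsLocallyFiniteMeasure (renewalMeasure P μ0) := by
    refine ⟨fun x => ⟨Set.Icc (x - 1) (x - 1 + 2), Icc_mem_nhds (by linarith) (by linarith), ?_⟩⟩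
    exact lt_of_le_of_lt (meas_Icc_le _ C hV _) ENNReal.coe_lt_top
  have hint : ∀ n, Integrable (fun y => f (y - t n)) (renewalMeasure P μ0) := fun n =>
    (hfc n).integrable_of_hasCompactSupport
      (hc.comp_homeomorph (Homeomorph.subRight (t n)))
  have hzero : Tendsto (fun n => ∫ y, f (y - t n) ∂μ0) atTop (nhds 0) := by
    have : (0 : ℝ) = ∫ y, (0 : ℝ) ∂μ0 := by simp
    rw [this]
    refine tendsto_integral_of_dominated_convergence (fun _ => M)
      (fun n => (hfc n).aestronglyMeasurable) (integrable_const _)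
      (fun n => Eventually.of_forall fun y => hM _) (Eventually.of_forall fun y => ?_)
    have h1 : Tendsto (fun n => y - t n) atTop (cocompact ℝ) := by
      refine Tendsto.mono_right ?_ atBot_le_cocompact
      exact tendsto_atBot_add_const_left atTop y (tendsto_neg_atTop_atBot.comp ht)
    exact hc.is_zero_at_infty.comp h1
  have := (hconv f hf hc).sub hzero
  rw [sub_zero] at this
  refine this.congr fun n => ?_
  have hi := hint n
  rw [renewal_succ, integrable_add_measure] at hi
  rw [renewal_succ, integral_add_measure hi.1 hi.2]
  ring

lemma balance_all
    (P : Kernel ℝ ℝ) [IsMarkovKernel P]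
    (F : Measure ℝ) [IsProbabilityMeasure F]
    (hweak : ∀ f : BoundedContinuousFunction ℝ ℝ,
      Tendsto (fun x : ℝ => ∫ s, f s ∂(jumpLaw P x)) atTop (nhds (∫ s, f s ∂F)))
    (hF : Integrable (fun s : ℝ => s) F)
    (C : NNReal)
    (B : ℤ → ℝ) (hB : Summable B)
    (hQB : ∀ y, ∀ j : ℤ, (jumpLaw P y).real {s : ℝ | |(j : ℝ)| - 4 < |s|} ≤ B j)
    (t : ℕ → ℝ) (ht : Tendsto t atTop atTop) (α : ℝ) (k : ℕ) :
    ∀ (μ0 : Measure ℝ) [IsProbabilityMeasure μ0]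
    (_ : ∀ k : ℤ, renewalMeasure P μ0 (Set.Ioc (k : ℝ) (k + 1)) ≤ C)
    (_ : ∀ f : ℝ → ℝ, Continuous f → HasCompactSupport f →
      Tendsto (fun n : ℕ => ∫ y, f (y - t n) ∂(renewalMeasure P μ0)) atTop
        (nhds (α * ∫ x, f x))),
    (chainDist P μ0 k).real (Set.Ioi (0 : ℝ)) =
        -(∫ y in Set.Iic (0 : ℝ), (P y).real (Set.Ioi (0 : ℝ)) ∂(renewalTail P μ0 k))
          + (∫ y in Set.Ioi (0 : ℝ), (P y).real (Set.Iic (0 : ℝ)) ∂(renewalTail P μ0 k))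
          + α * ∫ s, s ∂F := by
  induction k with
  | zero =>
    intro μ0 _ hV hconv
    rw [renewalTail_zero]
    exact balance_zero P μ0 F hweak hF C hV B hB hQB t ht α hconv
  | succ k ih =>
    intro μ0 _ hV hconv
    rw [renewalTail_succ, chainDist_succ']
    refine ih (μ0.bind P) (fun j => le_trans ?_ (hV j))
      (conv_step P μ0 C hV t ht α hconv)
    rw [renewal_succ P μ0, Measure.add_apply]
    exact le_add_self

end BalanceAux


/-- **The balance identity (15).** Under the assumptions of the key renewal
theorem, if `U(tₙ + dx) ⇒ α dx` along a sequence `tₙ → ∞`, then for every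
fixed `k`, writing `U_k = ∑_{j≥k} μ_j`,
`μ_k(0,∞) = -∫_{-∞}^0 P(y,(0,∞)) U_k(dy) + ∫_0^∞ P(y,(-∞,0]) U_k(dy) + α E ξ`. -/
theorem balance_identity
    (P : Kernel ℝ ℝ) [IsMarkovKernel P]
    (μ0 : Measure ℝ) [IsProbabilityMeasure μ0]
    (F : Measure ℝ) [IsProbabilityMeasure F]
    (ηm : Measure ℝ) [IsProbabilityMeasure ηm]
    -- (i) weak convergence of the jumps to `F` and positive drift:
    (hweak : ∀ f : BoundedContinuousFunction ℝ ℝ,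
      Tendsto (fun x : ℝ => ∫ s, f s ∂(jumpLaw P x)) atTop (nhds (∫ s, f s ∂F)))
    (hF_int : Integrable (fun s : ℝ => s) F)
    (hEpos : 0 < ∫ s, s ∂F)
    -- (ii) integrable stochastic majorant `η`:
    (hdom : ∀ x : ℝ, ∀ t : ℝ, jumpLaw P x {s : ℝ | t < |s|} ≤ ηm {s : ℝ | t < s})
    (hη_int : ∫⁻ s, ENNReal.ofReal |s| ∂ηm < ⊤)
    -- (iii) the renewal measure is bounded on unit intervals:
    (hU : (⨆ k : ℤ, renewalMeasure P μ0 (Set.Ioc (k : ℝ) (k + 1))) < ⊤)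
    -- a sequence `tₙ → ∞` along which `U(tₙ + dx) ⇒ α dx`:
    (t : ℕ → ℝ) (ht : Tendsto t atTop atTop)
    (α : ℝ) (hα : 0 ≤ α)
    (hconv : ∀ f : C(ℝ, ℝ), HasCompactSupport f →
      Tendsto (fun n : ℕ =>
          ∫ x, f x ∂((renewalMeasure P μ0).map (fun y => y - t n)))
        atTop (nhds (α * ∫ x, f x ∂(volume : Measure ℝ)))) :
    ∀ k : ℕ,
      ((chainDist P μ0 k) (Set.Ioi (0 : ℝ))).toReal =
        -(∫ y in Set.Iic (0 : ℝ), ((P y) (Set.Ioi (0 : ℝ))).toReal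
            ∂(renewalTail P μ0 k))
          + (∫ y in Set.Ioi (0 : ℝ), ((P y) (Set.Iic (0 : ℝ))).toReal
              ∂(renewalTail P μ0 k))
          + α * ∫ s, s ∂F := by
  intro k
  set C : NNReal := (⨆ k : ℤ, renewalMeasure P μ0 (Set.Ioc (k : ℝ) (k + 1))).toNNReal with hC
  have hV : ∀ k : ℤ, renewalMeasure P μ0 (Set.Ioc (k : ℝ) (k + 1)) ≤ C := by
    intro j
    rw [hC, ENNReal.coe_toNNReal hU.ne]
    exact le_iSup (fun k : ℤ => renewalMeasure P μ0 (Set.Ioc (k : ℝ) (k + 1))) j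
  have hηi : Integrable (fun s : ℝ => |s|) ηm := by
    refine ⟨by fun_prop, ?_⟩
    unfold HasFiniteIntegral
    refine lt_of_le_of_lt (le_of_eq ?_) hη_int
    refine lintegral_congr fun s => ?_
    rw [← ofReal_norm, Real.norm_eq_abs, abs_abs]
  refine BalanceAux.balance_all P F hweak hF_int C _ (BalanceAux.tail_summable ηm hηi) ?_
    t ht α k μ0 hV ?_
  · intro y j
    refine ENNReal.toReal_mono (measure_ne_top _ _) ((hdom y _).trans (measure_mono ?_))
    intro s hs
    exact lt_of_lt_of_le hs (le_abs_self s)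
  · intro f hf hc
    refine (hconv ⟨f, hf⟩ hc).congr fun n => ?_
    exact integral_map (measurable_id.sub_const _).aemeasurable hf.aestronglyMeasurable
end
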